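/- arXiv:1103.5185 — 3 statements merged into one kernel-verified Lean document; each statement's English description precedes it below -/
import Mathlib

section
/- Let (d, n, a) be a class-T triple and suppose dn²/(dna − 1) = [b_1, …, b_l] with all b_i ≥ 2. Then (d, 2n − a, n) is a class-T triple, and d(2n − a)²/(d(2n − a)n − 1) = [2, b_1, …, b_{l−1}, b_l + 1]; in particular, the Hirzebruch–Jung expansion of d(2n − a)²/(d(2n − a)n − 1) has length l + 1 and δ(d, 2n − a, n) = δ(d, n, a) + 1. -/
/-- The Hirzebruch–Jung (negative-regular) continued fraction
`[c_1, …, c_m] = c_1 − 1/(c_2 − 1/(⋯ − 1/c_m))`, defined recursively by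
`[c_m] = c_m` and `[c_i, …, c_m] = c_i − 1/[c_{i+1}, …, c_m]`
(with junk value `1` on the empty list). -/
def hjCF : List ℤ → ℚ
  | [] => 1
  | [c] => (c : ℚ)
  | c :: c' :: cs => (c : ℚ) - 1 / hjCF (c' :: cs)

theorem hj_aux (bl : ℤ) (bs : List ℤ) (hb : ∀ c ∈ bs ++ [bl], 2 ≤ c) :
    ∃ p q p' q' : ℤ, 0 ≤ q' ∧ q' < q ∧ q < p ∧ q' < p' ∧ q - q' ≤ p - p' ∧
      p' * q - p * q' = 1 ∧ hjCF (bs ++ [bl]) = (p : ℚ) / q ∧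
      hjCF (bs ++ [bl + 1]) = ((p + p' : ℤ) : ℚ) / ((q + q' : ℤ) : ℚ) := by
  induction bs with
  | nil =>
    have h2 : 2 ≤ bl := hb bl (by simp)
    refine ⟨bl, 1, 1, 0, by omega, by omega, by omega, by omega, by omega, by ring, ?_, ?_⟩
    · simp [hjCF]
    · simp [hjCF]
  | cons c cs ih =>
    have hc : 2 ≤ c := hb c (by simp)
    obtain ⟨p, q, p', q', h1, h2, h3, h4, h5, h6, h7, h8⟩ :=
      ih (fun x hx => hb x (by rw [List.cons_append]; exact List.mem_cons_of_mem _ hx))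
    have key : ∀ x : ℤ, hjCF (c :: cs ++ [x]) = (c : ℚ) - 1 / hjCF (cs ++ [x]) := by
      intro x
      cases cs <;> simp [hjCF]
    refine ⟨c * p - q, p, c * p' - q', p', by omega, by omega, by nlinarith, by nlinarith,
      by nlinarith, by linear_combination h6, ?_, ?_⟩
    · have hp : (p : ℚ) ≠ 0 := by exact_mod_cast (by omega : p ≠ 0)
      rw [key, h7, one_div_div]
      push_cast
      field_simp
    · have hp : ((p + p' : ℤ) : ℚ) ≠ 0 := by exact_mod_cast (by omega : p + p' ≠ 0)
      rw [key, h8, one_div_div, eq_div_iff hp, sub_mul, div_mul_cancel₀ _ hp]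
      push_cast
      ring

/-- The `t_L`-part of Lemma `lem:going-up` of the paper: if `(d, n, a)` is a
class-T triple with `dn²/(dna − 1) = [b_1, …, b_l]`, then `(d, 2n − a, n)` is
a class-T triple and `d(2n−a)²/(d(2n−a)n − 1) = [2, b_1, …, b_{l−1}, b_l + 1]`;
in particular the new expansion has length `l + 1` and
`δ(d, 2n − a, n) = δ(d, n, a) + 1`. -/
theorem hj_classT_tL (d n a : ℤ) (hd : 0 < d) (ha : 0 < a) (han : a < n)
    (hcop : IsCoprime n a) (bl : ℤ) (bs : List ℤ)
    (hb : ∀ c ∈ bs ++ [bl], 2 ≤ c)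
    (hcf : ((d * n ^ 2 : ℤ) : ℚ) / ((d * n * a - 1 : ℤ) : ℚ)
      = hjCF (bs ++ [bl])) :
    (0 < n ∧ n < 2 * n - a ∧ IsCoprime (2 * n - a) n) ∧
    ((d * (2 * n - a) ^ 2 : ℤ) : ℚ) / ((d * (2 * n - a) * n - 1 : ℤ) : ℚ)
      = hjCF (2 :: (bs ++ [bl + 1])) ∧
    (2 :: (bs ++ [bl + 1])).length = (bs ++ [bl]).length + 1 ∧
    (2 :: (bs ++ [bl + 1])).sum
        - (2 * (((2 :: (bs ++ [bl + 1])).length : ℤ)) + 1)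
      = (bs ++ [bl]).sum - (2 * (((bs ++ [bl]).length : ℤ)) + 1) + 1 := by
  refine ⟨⟨by omega, by omega, ?_⟩, ?_, by simp, ?_⟩
  · obtain ⟨u, v, h⟩ := hcop
    exact ⟨-v, u + 2 * v, by linear_combination h⟩
  · obtain ⟨p, q, p', q', h1, h2, h3, h4, h5, h6, h7, h8⟩ := hj_aux bl bs hb
    have hdn : 0 < d * n := by apply mul_pos <;> omega
    have hdna : 2 ≤ d * n * a := by nlinarith
    have hlt : d * n * a + 1 ≤ d * n ^ 2 := by nlinarith
    rw [h7, div_eq_div_iff (by exact_mod_cast (by omega : d * n * a - 1 ≠ 0))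
      (by exact_mod_cast (by omega : q ≠ 0))] at hcf
    have hcr : d * n ^ 2 * q = p * (d * n * a - 1) := by exact_mod_cast hcf
    have c1 : IsCoprime p q := ⟨-q', p', by linear_combination h6⟩
    have c2 : IsCoprime (d * n ^ 2) (d * n * a - 1) :=
      ⟨d * a ^ 2, -(d * n * a + 1), by ring⟩
    have hp : p = d * n ^ 2 :=
      Int.dvd_antisymm (by omega) (by omega) (c1.dvd_of_dvd_mul_right ⟨_, hcr⟩)
        (c2.dvd_of_dvd_mul_right ⟨_, hcr.symm⟩)
    have hq : q = d * n * a - 1 := by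
      rw [hp] at hcr
      exact mul_left_cancel₀ (by omega) hcr
    have hdv : d * n ^ 2 ∣ p' + d * n * a + 1 := by
      apply c2.dvd_of_dvd_mul_right
      refine ⟨q' + d * a ^ 2, ?_⟩
      rw [hp, hq] at h6
      linear_combination h6
    obtain ⟨k, hk⟩ := hdv
    have hk1 : k = 1 := by
      have : 0 < k := by nlinarith
      have : k < 2 := by nlinarith
      omega
    have hp' : p' = d * n ^ 2 - d * n * a - 1 := by rw [hk1] at hk; linarith
    have hq' : q' = d * n * a - 1 - d * a ^ 2 := by
      rw [hp, hq, hp'] at h6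
      have h0 : d * n ^ 2 ≠ 0 := by omega
      apply mul_left_cancel₀ h0
      linear_combination -h6
    have key : hjCF (2 :: (bs ++ [bl + 1])) = 2 - 1 / hjCF (bs ++ [bl + 1]) := by
      cases bs <;> simp [hjCF]
    have hP : p + p' = d * (2 * n - a) * n - 1 := by rw [hp, hp']; ring
    have hP0 : ((d * (2 * n - a) * n - 1 : ℤ) : ℚ) ≠ 0 := by
      rw [← hP]; exact_mod_cast (by omega : p + p' ≠ 0)
    rw [key, h8, one_div_div, hP, div_eq_iff hP0, sub_mul, div_mul_cancel₀ _ hP0, hq, hq']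
    push_cast
    ring
  · simp
    ring
end

section
/- Let (d, n, a) be a class-T triple, with Hirzebruch–Jung data (l; b_1, …, b_l; (p_i); (q_i)) for the pair (dn², dna − 1), and assume l ≥ 2. Then b_1·(dna − 1) ≥ dn² and (b_1 − 1)·(dna − 1) < dn² (equivalently, n/b_1 + 1/(dn) ≤ a < n/(b_1 − 1) + 1/(dn)), and b_l·(dn(n − a) − 1) ≥ dn² and (b_l − 1)·(dn(n − a) − 1) < dn² (equivalently, n/b_l + 1/(dn) ≤ n − a < n/(b_l − 1) + 1/(dn)). In particular, 1/b_1 + 1/b_l + 2/(dn²) ≤ 1. -/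
/-- Hirzebruch–Jung data for the pair `(n, q)`: an integer `l ≥ 1`, the entries
`b i ≥ 2` (for `1 ≤ i ≤ l`) of the Hirzebruch–Jung continued fraction
`n/q = [b_1, …, b_l]`, and the integer sequences `p i`, `s i` (for `0 ≤ i ≤ l+1`,
with `s` playing the role of the `q_i` of the paper) satisfying
`p_0 = 0`, `p_1 = 1`, `q_0 = n`, `q_1 = q`, the recurrences
`p_{i+1} = b_i p_i − p_{i−1}`, `q_{i+1} = b_i q_i − q_{i−1}`, and
`n = q_0 > q_1 > ⋯ > q_l = 1 > q_{l+1} = 0`. -/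
structure HJData (n q : ℤ) where
  l : ℕ
  b : ℕ → ℤ
  p : ℕ → ℤ
  s : ℕ → ℤ
  hl : 1 ≤ l
  hb : ∀ i, 1 ≤ i → i ≤ l → 2 ≤ b i
  hp0 : p 0 = 0
  hp1 : p 1 = 1
  hs0 : s 0 = n
  hs1 : s 1 = q
  hrecp : ∀ i, 1 ≤ i → i ≤ l → p (i + 1) = b i * p i - p (i - 1)
  hrecs : ∀ i, 1 ≤ i → i ≤ l → s (i + 1) = b i * s i - s (i - 1)
  hsdec : ∀ i, i ≤ l → s (i + 1) < s i
  hsl : s l = 1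
  hslast : s (l + 1) = 0

theorem hj_p_mono {N q : ℤ} (D : HJData N q) :
    ∀ i, i ≤ D.l → 0 ≤ D.p i ∧ D.p i < D.p (i + 1) := by
  intro i
  induction i with
  | zero => intro _; simp [D.hp0, D.hp1]
  | succ k ih =>
    intro hk
    obtain ⟨h0, h1⟩ := ih (by omega)
    have hb := D.hb (k + 1) (by omega) hk
    have hr := D.hrecp (k + 1) (by omega) hk
    simp only [Nat.add_sub_cancel] at hr
    refine ⟨by omega, ?_⟩
    rw [hr]
    nlinarith

theorem hj_wronskian {N q : ℤ} (D : HJData N q) :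
    ∀ i, i ≤ D.l → D.p (i + 1) * D.s i - D.p i * D.s (i + 1) = N := by
  intro i
  induction i with
  | zero => intro _; simp [D.hp0, D.hp1, D.hs0]
  | succ k ih =>
    intro hk
    have h := ih (by omega)
    have hr := D.hrecp (k + 1) (by omega) hk
    have hs := D.hrecs (k + 1) (by omega) hk
    simp only [Nat.add_sub_cancel] at hr hs
    rw [hr, hs]
    linarith

theorem hj_congr {N q : ℤ} (D : HJData N q) :
    ∀ i, i ≤ D.l → N ∣ q * D.p i - D.s i ∧ N ∣ q * D.p (i + 1) - D.s (i + 1) := by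
  intro i
  induction i with
  | zero => intro _; simp [D.hp0, D.hp1, D.hs0, D.hs1]
  | succ k ih =>
    intro hk
    obtain ⟨⟨u, hu⟩, ⟨v, hv⟩⟩ := ih (by omega)
    have hr := D.hrecp (k + 1) (by omega) hk
    have hs := D.hrecs (k + 1) (by omega) hk
    simp only [Nat.add_sub_cancel] at hr hs
    refine ⟨⟨v, hv⟩, ⟨D.b (k + 1) * v - u, ?_⟩⟩
    rw [hr, hs]
    linear_combination D.b (k + 1) * hv - hu

theorem hj_s_nonneg {N q : ℤ} (D : HJData N q) :
    ∀ j, j ≤ D.l + 1 → 0 ≤ D.s (D.l + 1 - j) := by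
  intro j
  induction j with
  | zero => intro _; simp [D.hslast]
  | succ k ih =>
    intro hk
    have h := ih (by omega)
    have h2 := D.hsdec (D.l + 1 - (k + 1)) (by omega)
    have e : D.l + 1 - (k + 1) + 1 = D.l + 1 - k := by omega
    rw [e] at h2
    omega

/-- The inequalities (eq:n=2:1) from the proof of Lemma `lem:n=2` of the
paper: for a class-T triple `(d, n, a)` with `l ≥ 2`, one has
`b_1(dna − 1) ≥ dn²`, `(b_1 − 1)(dna − 1) < dn²`,
`b_l(dn(n − a) − 1) ≥ dn²`, `(b_l − 1)(dn(n − a) − 1) < dn²`;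
in particular `1/b_1 + 1/b_l + 2/(dn²) ≤ 1`. -/
theorem hj_classT_end_inequalities (d n a : ℤ) (hd : 0 < d) (ha : 0 < a)
    (han : a < n) (hcop : IsCoprime n a)
    (D : HJData (d * n ^ 2) (d * n * a - 1)) (h2l : 2 ≤ D.l) :
    d * n ^ 2 ≤ D.b 1 * (d * n * a - 1) ∧
    (D.b 1 - 1) * (d * n * a - 1) < d * n ^ 2 ∧
    d * n ^ 2 ≤ D.b D.l * (d * n * (n - a) - 1) ∧
    (D.b D.l - 1) * (d * n * (n - a) - 1) < d * n ^ 2 ∧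
    (1 : ℚ) / ((D.b 1 : ℤ) : ℚ) + 1 / ((D.b D.l : ℤ) : ℚ)
        + 2 / ((d * n ^ 2 : ℤ) : ℚ) ≤ 1 := by
  have hn : 0 < n := by omega
  have hN : 0 < d * n ^ 2 := by positivity
  have hdn : 0 < d * n := by positivity
  have hdna : 0 < d * n * (n - a) := mul_pos hdn (by omega)
  have hdna' : 0 < d * n * a := by positivity
  have hsum : d * n * a + d * n * (n - a) = d * n ^ 2 := by ring
  have hlast : D.p (D.l + 1) = d * n ^ 2 := by
    have := hj_wronskian D D.l le_rfl
    rw [D.hsl, D.hslast] at this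
    linarith
  obtain ⟨hp0, hp1⟩ := hj_p_mono D D.l le_rfl
  rw [hlast] at hp1
  have hpl : D.p D.l = d * n * (n - a) - 1 := by
    obtain ⟨u, hu⟩ := (hj_congr D D.l le_rfl).1
    rw [D.hsl] at hu
    have hdvd : d * n ^ 2 ∣ D.p D.l - (d * n * (n - a) - 1) :=
      ⟨(d * n * (n - a) - 1) * u - (d * a * (n - a) - 1) * D.p D.l, by
        linear_combination (d * n * (n - a) - 1) * hu⟩
    have := Int.eq_zero_of_abs_lt_dvd hdvd (by rw [abs_lt]; constructor <;> linarith)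
    linarith
  have hs2 : 0 ≤ D.s 2 := by
    have := hj_s_nonneg D (D.l - 1) (by omega)
    rwa [show D.l + 1 - (D.l - 1) = 2 by omega] at this
  have hs2' := D.hsdec 1 (by omega)
  have hrs := D.hrecs 1 le_rfl (by omega)
  norm_num [D.hs0, D.hs1] at hrs hs2'
  have hrp := D.hrecp D.l (by omega) le_rfl
  rw [hlast, hpl] at hrp
  obtain ⟨hq0, hq1⟩ := hj_p_mono D (D.l - 1) (by omega)
  rw [show D.l - 1 + 1 = D.l by omega, hpl] at hq1
  have hb1 := D.hb 1 le_rfl (by omega)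
  have hbl := D.hb D.l (by omega) le_rfl
  have A : d * n ^ 2 ≤ D.b 1 * (d * n * a - 1) := by linarith
  have B : d * n ^ 2 ≤ D.b D.l * (d * n * (n - a) - 1) := by linarith
  refine ⟨A, by linarith, B, by linarith, ?_⟩
  have key : ∀ N b x : ℤ, 0 < N → 2 ≤ b → N ≤ b * x → (1 : ℚ) / (b : ℚ) ≤ (x : ℚ) / (N : ℚ) := by
    intro N b x hN hb h
    have hN' : (0 : ℚ) < N := by exact_mod_cast hN
    have hb' : (0 : ℚ) < b := by exact_mod_cast (by omega : 0 < b)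
    rw [div_le_div_iff₀ hb' hN']
    have : (N : ℚ) ≤ b * x := by exact_mod_cast h
    linarith
  have k1 := key _ _ _ hN hb1 A
  have k2 := key _ _ _ hN hbl B
  have hN' : (0 : ℚ) < ((d * n ^ 2 : ℤ) : ℚ) := by exact_mod_cast hN
  have hs : ((d * n * a - 1 : ℤ) : ℚ) / ((d * n ^ 2 : ℤ) : ℚ)
      + ((d * n * (n - a) - 1 : ℤ) : ℚ) / ((d * n ^ 2 : ℤ) : ℚ)
      + 2 / ((d * n ^ 2 : ℤ) : ℚ) = 1 := by
    rw [← add_div, ← add_div, div_eq_one_iff_eq hN'.ne']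
    push_cast
    ring
  linarith
end

section
/- Let (d, n, a) be a class-T triple and suppose dn²/(dna − 1) = [b_1, …, b_l] with all b_i ≥ 2. Then (d, n, n − a) is a class-T triple, and dn²/(dn(n − a) − 1) = [b_l, b_{l−1}, …, b_1]. -/
def hjA (c : ℤ) : Matrix (Fin 2) (Fin 2) ℤ := !![c, -1; 1, 0]

def hjM (L : List ℤ) : Matrix (Fin 2) (Fin 2) ℤ := (L.map hjA).prod

lemma hjM_cons (c : ℤ) (L : List ℤ) : hjM (c :: L) = hjA c * hjM L := by
  simp [hjM]

lemma hjM_append (K L : List ℤ) : hjM (K ++ L) = hjM K * hjM L := by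
  simp [hjM]

lemma hjM_cons_00 (c : ℤ) (L : List ℤ) : hjM (c :: L) 0 0 = c * hjM L 0 0 - hjM L 1 0 := by
  rw [hjM_cons]; simp [hjA, Matrix.mul_apply, Fin.sum_univ_two]; ring

lemma hjM_cons_10 (c : ℤ) (L : List ℤ) : hjM (c :: L) 1 0 = hjM L 0 0 := by
  rw [hjM_cons]; simp [hjA, Matrix.mul_apply, Fin.sum_univ_two]

lemma hjM_cons_01 (c : ℤ) (L : List ℤ) : hjM (c :: L) 0 1 = c * hjM L 0 1 - hjM L 1 1 := by
  rw [hjM_cons]; simp [hjA, Matrix.mul_apply, Fin.sum_univ_two]; ring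

lemma hjM_cons_11 (c : ℤ) (L : List ℤ) : hjM (c :: L) 1 1 = hjM L 0 1 := by
  rw [hjM_cons]; simp [hjA, Matrix.mul_apply, Fin.sum_univ_two]

lemma hjM_det (L : List ℤ) : hjM L 0 0 * hjM L 1 1 - hjM L 0 1 * hjM L 1 0 = 1 := by
  induction L with
  | nil => simp [hjM]
  | cons c L ih =>
    rw [hjM_cons_00, hjM_cons_10, hjM_cons_01, hjM_cons_11]; linarith

lemma hjM_reverse (L : List ℤ) : hjM L.reverse 0 0 = hjM L 0 0 ∧
    hjM L.reverse 1 0 = - hjM L 0 1 ∧ hjM L.reverse 0 1 = - hjM L 1 0 ∧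
    hjM L.reverse 1 1 = hjM L 1 1 := by
  induction L with
  | nil => simp [hjM]
  | cons c L ih =>
    obtain ⟨h1, h2, h3, h4⟩ := ih
    have hc : hjM [c] = hjA c := by simp [hjM]
    rw [hjM_cons_00, hjM_cons_10, hjM_cons_01, hjM_cons_11, List.reverse_cons, hjM_append, hc]
    simp only [Matrix.mul_apply, Fin.sum_univ_two, h1, h2, h3, h4, hjA]
    simp
    constructor <;> ring

lemma hjM_bound (L : List ℤ) (hb : ∀ c ∈ L, 2 ≤ c) :
    0 ≤ hjM L 1 0 ∧ hjM L 1 0 < hjM L 0 0 := by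
  induction L with
  | nil => simp [hjM]
  | cons c L ih =>
    obtain ⟨h1, h2⟩ := ih (fun x hx => hb x (by simp [hx]))
    have := hb c (by simp)
    rw [hjM_cons_00, hjM_cons_10]
    constructor
    · omega
    · nlinarith

lemma hjCF_eq (L : List ℤ) (hb : ∀ c ∈ L, 2 ≤ c) (hL : L ≠ []) :
    hjCF L = (hjM L 0 0 : ℚ) / (hjM L 1 0 : ℚ) := by
  induction L with
  | nil => exact absurd rfl hL
  | cons c L ih =>
    cases L with
    | nil => simp [hjCF, hjM, hjA]
    | cons c' L =>
      have hb' : ∀ x ∈ c' :: L, 2 ≤ x := fun x hx => hb x (List.mem_cons_of_mem _ hx)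
      obtain ⟨h1, h2⟩ := hjM_bound _ hb'
      have h3 : ((hjM (c' :: L) 0 0 : ℤ) : ℚ) ≠ 0 := by
        have : hjM (c' :: L) 0 0 ≠ 0 := by omega
        exact_mod_cast this
      rw [hjCF, ih hb' (by simp), hjM_cons_00 c, hjM_cons_10 c]
      push_cast
      rw [one_div_div, sub_div, mul_div_cancel_right₀ _ h3]

/-- The reversal statement for the involution `i(d, n, a) = (d, n, n − a)` from
the proof of Lemma `lem:going-up` of the paper: if `(d, n, a)` is a class-T
triple with `dn²/(dna − 1) = [b_1, …, b_l]`, then `(d, n, n − a)` is a class-T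
triple and `dn²/(dn(n − a) − 1) = [b_l, b_{l−1}, …, b_1]`. -/
theorem hj_classT_reverse (d n a : ℤ) (hd : 0 < d) (ha : 0 < a) (han : a < n)
    (hcop : IsCoprime n a) (L : List ℤ)
    (hb : ∀ c ∈ L, 2 ≤ c)
    (hcf : ((d * n ^ 2 : ℤ) : ℚ) / ((d * n * a - 1 : ℤ) : ℚ) = hjCF L) :
    (0 < n - a ∧ n - a < n ∧ IsCoprime n (n - a)) ∧
    ((d * n ^ 2 : ℤ) : ℚ) / ((d * n * (n - a) - 1 : ℤ) : ℚ)
      = hjCF L.reverse := by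
  refine ⟨⟨by omega, by omega, ?_⟩, ?_⟩
  · obtain ⟨u, v, h⟩ := hcop
    exact ⟨u + v, -v, by linarith⟩
  have hdn : 2 ≤ d * n := by nlinarith
  have hq : 0 < d * n * a - 1 := by nlinarith
  have hq' : 0 < d * n * (n - a) - 1 := by nlinarith
  have hp : d * n * (n - a) - 1 < d * n ^ 2 := by nlinarith
  have hqQ : ((d * n * a - 1 : ℤ) : ℚ) ≠ 0 := by exact_mod_cast hq.ne'
  have hL : L ≠ [] := by
    rintro rfl
    rw [hjCF, div_eq_one_iff_eq hqQ] at hcf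
    have : d * n ^ 2 = d * n * a - 1 := by exact_mod_cast hcf
    nlinarith
  have hbr : ∀ c ∈ L.reverse, 2 ≤ c := fun c hc => hb c (by simpa using hc)
  rw [hjCF_eq L.reverse hbr (by simpa using hL)]
  rw [hjCF_eq L hb hL] at hcf
  obtain ⟨b1, b2⟩ := hjM_bound L hb
  obtain ⟨c1, c2⟩ := hjM_bound _ hbr
  obtain ⟨r1, r2, -, -⟩ := hjM_reverse L
  have hdet := hjM_det L
  rw [r1, r2] at c2
  rw [r2] at c1
  rw [r1, r2]
  clear r1 r2
  generalize hjM L 0 0 = p at *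
  generalize hjM L 0 1 = q at *
  generalize hjM L 1 0 = r at *
  generalize hjM L 1 1 = s at *
  have hr : 0 < r := by
    rcases b1.lt_or_eq with h | h
    · exact h
    · exfalso
      rw [← h] at hcf
      simp only [Int.cast_zero, div_zero] at hcf
      have : ((d * n ^ 2 : ℤ) : ℚ) ≠ 0 := by
        have : d * n ^ 2 ≠ 0 := by omega
        exact_mod_cast this
      exact (div_ne_zero this hqQ) hcf
  have hrQ : (r : ℚ) ≠ 0 := by exact_mod_cast hr.ne'
  rw [div_eq_div_iff hqQ hrQ] at hcf
  have hx : d * n ^ 2 * r = p * (d * n * a - 1) := by exact_mod_cast hcf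
  have cop1 : IsCoprime p r := ⟨s, -q, by linarith⟩
  have cop2 : IsCoprime (d * n ^ 2) (d * n * a - 1) :=
    ⟨d * a ^ 2, -(d * n * a + 1), by ring⟩
  have d1 : p ∣ d * n ^ 2 := cop1.dvd_of_dvd_mul_right ⟨_, hx⟩
  have d2 : d * n ^ 2 ∣ p := cop2.dvd_of_dvd_mul_right ⟨_, hx.symm⟩
  have hpe : p = d * n ^ 2 := Int.dvd_antisymm (by omega) (by omega) d1 d2
  have hre : r = d * n * a - 1 := by
    rw [hpe] at hx
    exact mul_left_cancel₀ (by omega) hx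
  have d3 : p ∣ r * (-q - (d * n * (n - a) - 1)) := by
    refine ⟨-s - (d * a * (n - a) - 1), ?_⟩
    have : r * (d * n * (n - a) - 1) = p * (d * a * (n - a) - 1) + 1 := by
      rw [hre, hpe]; ring
    linarith
  have d4 := cop1.dvd_of_dvd_mul_left d3
  have h0 : -q - (d * n * (n - a) - 1) = 0 := by
    apply Int.eq_zero_of_abs_lt_dvd d4
    rw [abs_lt]; constructor <;> omega
  have h1 : -q = d * n * (n - a) - 1 := by omega
  rw [h1, hpe]
end
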